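/- arXiv:2503.03454 — 6 statements merged into one kernel-verified Lean document; each statement's English description precedes it below -/
import Mathlib

section
/- For every natural number n ≥ 1 and every vector f : Fin n → ℝ, there exists a unique real number δ such that ∑_{i} max(f i − δ, 0) = 1. -/
theorem sum_max_sub_lt_of_lt {ι : Type*} [Fintype ι] (f : ι → ℝ) {a b : ℝ} (hab : a < b)
    (hb : 0 < ∑ i, max (f i - b) 0) : ∑ i, max (f i - b) 0 < ∑ i, max (f i - a) 0 := by
  obtain ⟨i, hi, hpos⟩ := Finset.exists_lt_of_sum_lt (s := Finset.univ) (f := fun _ : ι ↦ (0 : ℝ))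
    (g := fun i ↦ max (f i - b) 0) (by simpa using hb)
  refine Finset.sum_lt_sum (fun j _ ↦ by gcongr) ⟨i, hi, ?_⟩
  have hfi : 0 < f i - b := by simpa using hpos
  rw [max_eq_left hfi.le]
  exact lt_max_of_lt_left (by linarith)

theorem exists_sum_max_sub_eq {ι : Type*} [Fintype ι] [Nonempty ι] (f : ι → ℝ) {c : ℝ}
    (hc : 0 ≤ c) : ∃ δ : ℝ, ∑ i, max (f i - δ) 0 = c := by
  obtain ⟨i, hi⟩ := Finite.exists_max f
  have hcont : ContinuousOn (fun δ : ℝ ↦ ∑ j, max (f j - δ) 0) (Set.Icc (f i - c) (f i)) := by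
    fun_prop
  have hupper : c ≤ ∑ j, max (f j - (f i - c)) 0 := by
    refine le_trans ?_ (Finset.single_le_sum (f := fun j ↦ max (f j - (f i - c)) 0)
      (fun j _ ↦ le_max_right _ _) (Finset.mem_univ i))
    simp
  have hlower : ∑ j, max (f j - f i) 0 = 0 :=
    Finset.sum_eq_zero fun j _ ↦ max_eq_right (sub_nonpos.2 (hi j))
  obtain ⟨δ, -, hδ⟩ := intermediate_value_Icc' (by linarith) hcont
    ⟨hlower.trans_le hc, hupper⟩
  exact ⟨δ, hδ⟩

/-- **Norm-Sub threshold: existence and uniqueness.**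
For every natural number `n ≥ 1` and every vector `f : Fin n → ℝ`, there exists a
unique real number `δ` such that `∑ i, max (f i - δ) 0 = 1`. -/
theorem normSub_threshold_existsUnique (n : ℕ) (hn : 1 ≤ n) (f : Fin n → ℝ) :
    ∃! δ : ℝ, ∑ i : Fin n, max (f i - δ) 0 = 1 := by
  have : Nonempty (Fin n) := ⟨⟨0, hn⟩⟩
  refine existsUnique_of_exists_of_unique (exists_sum_max_sub_eq f zero_le_one) ?_
  intro a b ha hb
  rcases lt_trichotomy a b with h | h | h
  · have := sum_max_sub_lt_of_lt f h (by rw [hb]; exact one_pos)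
    linarith
  · exact h
  · have := sum_max_sub_lt_of_lt f h (by rw [ha]; exact one_pos)
    linarith
end

section
/- Let n ≥ 1 and let f, g : Fin n → ℝ with f i ≤ g i for every i. If δ_f is a Norm-Sub threshold of f (i.e., ∑_{i} max(f i − δ_f, 0) = 1) and δ_g is a Norm-Sub threshold of g, then δ_f ≤ δ_g. -/
/-- **Monotonicity of the Norm-Sub threshold.**
If `f i ≤ g i` for every `i`, and `δf`, `δg` are Norm-Sub thresholds of `f` and `g`
respectively, then `δf ≤ δg`. -/
theorem normSub_threshold_mono (n : ℕ) (hn : 1 ≤ n) (f g : Fin n → ℝ)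
    (hfg : ∀ i, f i ≤ g i) (δf δg : ℝ)
    (hδf : ∑ i : Fin n, max (f i - δf) 0 = 1)
    (hδg : ∑ i : Fin n, max (g i - δg) 0 = 1) :
    δf ≤ δg := by
  by_contra! h
  obtain ⟨i, -, hi⟩ : ∃ i ∈ Finset.univ, 0 < max (f i - δf) 0 :=
    Finset.exists_lt_of_sum_lt (by simp [hδf])
  have hi' : 0 < f i - δf := by simpa using hi
  have hlt : ∑ j, max (f j - δf) 0 < ∑ j, max (g j - δg) 0 := by
    refine Finset.sum_lt_sum (fun j _ => max_le_max_right 0 (by linarith [hfg j]))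
      ⟨i, Finset.mem_univ i, ?_⟩
    rw [max_eq_left hi'.le]
    exact lt_max_of_lt_left (by linarith [hfg i])
  linarith
end

section
/- Let n ≥ 1, let f, g : Fin n → ℝ, and let t ≥ 0 be such that |f i − g i| ≤ t for every i. If δ_f is a Norm-Sub threshold of f and δ_g is a Norm-Sub threshold of g, then |δ_f − δ_g| ≤ t. In particular, the Norm-Sub threshold is a 1-Lipschitz function of the frequency vector with respect to the supremum norm. -/
/-- If `f ≤ g + t` pointwise and the truncated sums of `f` and `g` at `a` and `b` share a positive
value, then `a ≤ b + t`. -/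
theorem threshold_le_add_of_le_add {ι : Type*} [Fintype ι] {f g : ι → ℝ} {t a b c : ℝ}
    (hc : 0 < c) (hfg : ∀ i, f i ≤ g i + t) (ha : ∑ i, max (f i - a) 0 = c)
    (hb : ∑ i, max (g i - b) 0 = c) : a ≤ b + t := by
  by_contra! h
  obtain ⟨j, -, hj⟩ : ∃ j ∈ Finset.univ, 0 < max (f j - a) 0 :=
    Finset.exists_lt_of_sum_lt (by simpa [ha] using hc)
  have hj' : 0 < f j - a := by simpa using hj
  have hlt : ∑ i, max (f i - a) 0 < ∑ i, max (g i - b) 0 := by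
    refine Finset.sum_lt_sum (fun i _ => max_le_max_right 0 ?_) ⟨j, Finset.mem_univ j, ?_⟩
    · linarith [hfg i]
    · rw [max_eq_left hj'.le]
      exact lt_max_of_lt_left (by linarith [hfg j])
  exact hlt.ne (ha.trans hb.symm)

/-- **The Norm-Sub threshold is 1-Lipschitz in the sup norm.**
If `|f i - g i| ≤ t` for every `i` (with `t ≥ 0`), and `δf`, `δg` are Norm-Sub
thresholds of `f` and `g` respectively, then `|δf - δg| ≤ t`. -/
theorem normSub_threshold_lipschitz (n : ℕ) (hn : 1 ≤ n) (f g : Fin n → ℝ)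
    (t : ℝ) (ht : 0 ≤ t) (hfg : ∀ i, |f i - g i| ≤ t) (δf δg : ℝ)
    (hδf : ∑ i : Fin n, max (f i - δf) 0 = 1)
    (hδg : ∑ i : Fin n, max (g i - δg) 0 = 1) :
    |δf - δg| ≤ t := by
  rw [abs_sub_le_iff]
  constructor
  · linarith [threshold_le_add_of_le_add (t := t) one_pos
      (fun i => by linarith [(abs_sub_le_iff.1 (hfg i)).1]) hδf hδg]
  · linarith [threshold_le_add_of_le_add (t := t) one_pos
      (fun i => by linarith [(abs_sub_le_iff.1 (hfg i)).2]) hδg hδf]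
end

section
/- Let n ≥ 1, let b : Fin n → ℝ, let c : Fin n → ℝ, and let u > 0 and M > 0 be reals. For each assignment a : Fin n → ℝ with 0 ≤ a i ≤ M for all i, let δ(a) be the unique Norm-Sub threshold of the vector i ↦ b i + u · a i, and define the objective Φ(a) = ∑_{i} c i · max(b i + u · a i − δ(a), 0). Then Φ attains its maximum on the cube {a : Fin n → ℝ | ∀ i, 0 ≤ a i ≤ M}: there exists a* in the cube with Φ(a) ≤ Φ(a*) for all a in the cube. -/
/-- Norm-Sub thresholds are monotone and translation-equivariant: if `f ≤ g + r` pointwise, then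
the threshold of `f` is at most `r` more than the threshold of `g`. -/
theorem normSub_threshold_le_add {ι : Type*} [Fintype ι] {f g : ι → ℝ} {s t r : ℝ}
    (hf : ∑ i, max (f i - s) 0 = 1) (hg : ∑ i, max (g i - t) 0 = 1)
    (hfg : ∀ i, f i ≤ g i + r) : s ≤ t + r := by
  by_contra! hlt
  obtain ⟨j, -, hj⟩ : ∃ j ∈ Finset.univ, 0 < max (f j - s) 0 := by
    refine Finset.exists_lt_of_sum_lt (f := fun _ => (0 : ℝ)) ?_
    simp [hf]
  have hj' : 0 < f j - s := by simpa using hj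
  have hsum : ∑ i, max (f i - s) 0 < ∑ i, max (g i - t) 0 := by
    refine Finset.sum_lt_sum (fun i _ => max_le_max_right 0 ?_) ⟨j, Finset.mem_univ j, ?_⟩
    · linarith [hfg i]
    · rw [max_eq_left hj'.le]
      exact lt_max_of_lt_left (by linarith [hfg j])
  linarith

/-- Any choice of Norm-Sub thresholds for the vectors `i ↦ b i + u * a i`, `a ∈ S`, is continuous
in `a` on `S`. -/
theorem continuousOn_normSub_threshold {ι : Type*} [Fintype ι] {b : ι → ℝ} {u : ℝ} (hu : 0 ≤ u)
    {S : Set (ι → ℝ)} {δ : (ι → ℝ) → ℝ}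
    (hδ : ∀ a ∈ S, ∑ i, max (b i + u * a i - δ a) 0 = 1) : ContinuousOn δ S := by
  refine (LipschitzOnWith.of_le_add_mul (⟨u, hu⟩ : NNReal) fun x hx y hy => ?_).continuousOn
  refine normSub_threshold_le_add (hδ x hx) (hδ y hy) fun i => ?_
  have hi : x i - y i ≤ dist x y := (le_abs_self _).trans (dist_le_pi_dist x y i)
  have := mul_le_mul_of_nonneg_left hi hu
  change _ ≤ _ + u * dist x y
  linarith

/-- **The tree-attack objective attains its maximum on the cube of assignments.**
For each assignment `a` in the cube `{a | ∀ i, 0 ≤ a i ≤ M}`, let `δ a` be the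
(unique) Norm-Sub threshold of the vector `i ↦ b i + u * a i`.  Then the objective
`Φ a = ∑ i, c i * max (b i + u * a i - δ a) 0` attains its maximum on the cube. -/
theorem tree_attack_objective_attains_max (n : ℕ) (hn : 1 ≤ n)
    (b c : Fin n → ℝ) (u M : ℝ) (hu : 0 < u) (hM : 0 < M)
    (δ : (Fin n → ℝ) → ℝ)
    (hδ : ∀ a : Fin n → ℝ, (∀ i, 0 ≤ a i ∧ a i ≤ M) →
      ∑ i : Fin n, max (b i + u * a i - δ a) 0 = 1) :
    ∃ astar : Fin n → ℝ, (∀ i, 0 ≤ astar i ∧ astar i ≤ M) ∧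
      ∀ a : Fin n → ℝ, (∀ i, 0 ≤ a i ∧ a i ≤ M) →
        ∑ i : Fin n, c i * max (b i + u * a i - δ a) 0 ≤
          ∑ i : Fin n, c i * max (b i + u * astar i - δ astar) 0 := by
 
  have hmem : ∀ a : Fin n → ℝ, a ∈ Set.Icc 0 (fun _ => M) ↔ ∀ i, 0 ≤ a i ∧ a i ≤ M := fun a => by
    simp [Set.mem_Icc, Pi.le_def, forall_and]
  have hcont : ContinuousOn δ (Set.Icc 0 (fun _ => M)) :=
    continuousOn_normSub_threshold hu.le fun a ha => hδ a ((hmem a).1 ha)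
  obtain ⟨a, ha, hmax⟩ := isCompact_Icc.exists_isMaxOn
    (f := fun a => ∑ i, c i * max (b i + u * a i - δ a) 0)
    ⟨0, (hmem 0).2 fun _ => ⟨le_rfl, hM.le⟩⟩ (by fun_prop)
  exact ⟨a, (hmem a).1 ha, fun x hx => hmax ((hmem x).2 hx)⟩
end

section
/- Let n ≥ 1, let f : Fin n → ℝ, and let δ be a Norm-Sub threshold of f. Let S and T be finite sets of indices with T ⊆ S, let w = |T| ≥ 1 (as a natural number), and suppose that for every i ∈ T and every j ∉ S we have f i > f j + 1/w. Then f j ≤ δ for every j ∉ S; consequently max(f j − δ, 0) = 0 for every j ∉ S, i.e., after Norm-Sub all mass is concentrated on S. -/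
/-- **Concentration after Norm-Sub (key step of the paper's Theorem 3).**
Let `δ` be a Norm-Sub threshold of `f`, let `T ⊆ S` be sets of indices with
`w = |T| ≥ 1`, and suppose every entry in `T` exceeds every entry outside `S`
by more than `1/w`.  Then every entry outside `S` is at most `δ`, hence its
Norm-Sub output is `0`: all mass is concentrated on `S`. -/
theorem normSub_concentration (n : ℕ) (hn : 1 ≤ n) (f : Fin n → ℝ) (δ : ℝ)
    (hδ : ∑ i : Fin n, max (f i - δ) 0 = 1)
    (S T : Finset (Fin n)) (hTS : T ⊆ S) (w : ℕ) (hw : w = T.card) (hw1 : 1 ≤ w)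
    (hgap : ∀ i ∈ T, ∀ j ∉ S, f i > f j + 1 / (w : ℝ)) :
    ∀ j ∉ S, f j ≤ δ ∧ max (f j - δ) 0 = 0 := by
  intro j hj
  have hle : f j ≤ δ := by
    by_contra! hlt
    have hT : T.Nonempty := Finset.card_pos.mp (by omega)
    have hw0 : (w : ℝ) ≠ 0 := by exact_mod_cast (by omega : w ≠ 0)
    have hlow : ∑ _i ∈ T, (1 / (w : ℝ)) < ∑ i ∈ T, max (f i - δ) 0 :=
      Finset.sum_lt_sum_of_nonempty hT fun i hi =>
        lt_max_of_lt_left (by linarith [hgap i hi j hj])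
    have hup : ∑ i ∈ T, max (f i - δ) 0 ≤ ∑ i : Fin n, max (f i - δ) 0 :=
      Finset.sum_le_sum_of_subset_of_nonneg (Finset.subset_univ T)
        fun _ _ _ => le_max_right _ _
    rw [Finset.sum_const, ← hw, nsmul_eq_mul, mul_one_div_cancel hw0] at hlow
    linarith
  exact ⟨hle, max_eq_right (sub_nonpos.mpr hle)⟩
end

section
/- Let T be a finite rooted tree in which every node carries a real label (formalized as the inductive type of finitely branching real-labeled trees: a node consists of a label x : ℝ and a list of child subtrees). Define the consistency value f̃(T) recursively by: f̃(node x []) = x, and for a node with nonempty child list cs, f̃(node x cs) = λ · x + (1 − λ) · ∑_{c ∈ cs} f̃(c), where λ = |cs| / (|cs| + 1). Then for every tree shape there exist nonnegative coefficients, one for each node position of the shape, such that for every assignment of real labels to the nodes of that shape, f̃ of the resulting labeled tree equals the sum over node positions of the coefficient times the label at that position. In particular, f̃ is a monotone, ℝ-linear function of the node labels. -/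
/-- Finitely branching trees with real-valued node labels. -/
inductive RTree : Type where
  | node (label : ℝ) (children : List RTree) : RTree

/-- Tree shapes: finitely branching trees without labels. -/
inductive TreeShape : Type where
  | node (children : List TreeShape) : TreeShape

/-- The shape of a labeled tree. -/
def RTree.shape : RTree → TreeShape
  | .node _ cs => .node (cs.attach.map (fun t => RTree.shape t.1))
  decreasing_by
    have h : sizeOf t.1 < sizeOf cs := List.sizeOf_lt_of_mem t.2
    simp only [RTree.node.sizeOf_spec]
    omega

/-- AHEAD's consistency value: `f̃(node x []) = x` and, for a nonempty child
list `cs`, `f̃(node x cs) = λ·x + (1-λ)·∑_{c ∈ cs} f̃(c)` with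
`λ = |cs|/(|cs|+1)`. -/
noncomputable def RTree.tilde : RTree → ℝ
  | .node x [] => x
  | .node x (c :: cs) =>
      (((c :: cs).length : ℝ) / (((c :: cs).length : ℝ) + 1)) * x +
        (1 - ((c :: cs).length : ℝ) / (((c :: cs).length : ℝ) + 1)) *
          (((c :: cs).attach.map (fun t => RTree.tilde t.1)).sum)
  decreasing_by
    have h : sizeOf t.1 < sizeOf (c :: cs) := List.sizeOf_lt_of_mem t.2
    simp only [List.cons.sizeOf_spec] at h
    simp only [RTree.node.sizeOf_spec, List.cons.sizeOf_spec]
    omega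

/-- All labels of the tree are nonnegative. -/
def RTree.allNonneg : RTree → Prop
  | .node x cs => 0 ≤ x ∧ ∀ t ∈ cs.attach, RTree.allNonneg t.1
  decreasing_by
    have h : sizeOf t.1 < sizeOf cs := List.sizeOf_lt_of_mem t.2
    simp only [RTree.node.sizeOf_spec]
    omega

/-- Sum over node positions of the product of the labels of two same-shape
trees (the coefficient tree and the label tree). -/
noncomputable def RTree.dot : RTree → RTree → ℝ
  | .node x cs, .node y ds =>
      x * y + (((cs.zip ds).attach.map (fun p => RTree.dot p.1.1 p.1.2)).sum)
  decreasing_by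
    have h := List.of_mem_zip (by simpa using p.2)
    have : sizeOf p.1.1 < sizeOf cs := List.sizeOf_lt_of_mem h.1
    simp only [RTree.node.sizeOf_spec]
    omega

theorem RTree.shape_node (x : ℝ) (cs : List RTree) :
    (RTree.node x cs).shape = .node (cs.map RTree.shape) := by
  rw [RTree.shape, List.attach_map_val (f := RTree.shape)]

theorem RTree.allNonneg_node (x : ℝ) (cs : List RTree) :
    (RTree.node x cs).allNonneg ↔ 0 ≤ x ∧ ∀ t ∈ cs, t.allNonneg := by
  rw [RTree.allNonneg]
  simp

theorem RTree.dot_node (x y : ℝ) (cs ds : List RTree) :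
    (RTree.node x cs).dot (.node y ds) =
      x * y + ((cs.zip ds).map fun p => p.1.dot p.2).sum := by
  rw [RTree.dot, List.attach_map_val (f := fun p : RTree × RTree => p.1.dot p.2)]

/-- The weight given to a node's own label when the node has `n` children. -/
noncomputable def selfWeight (n : ℕ) : ℝ :=
  if n = 0 then 1 else (n : ℝ) / ((n : ℝ) + 1)

theorem selfWeight_nonneg (n : ℕ) : 0 ≤ selfWeight n := by
  unfold selfWeight
  split_ifs <;> positivity

theorem selfWeight_le_one (n : ℕ) : selfWeight n ≤ 1 := by
  unfold selfWeight
  split_ifs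
  · exact le_rfl
  · exact div_le_one_of_le₀ (by linarith) (by positivity)

theorem RTree.tilde_node (x : ℝ) (cs : List RTree) :
    (RTree.node x cs).tilde =
      selfWeight cs.length * x + (1 - selfWeight cs.length) * (cs.map RTree.tilde).sum := by
  cases cs with
  | nil => simp [RTree.tilde, selfWeight]
  | cons c cs =>
    rw [RTree.tilde, List.attach_map_val (f := RTree.tilde), selfWeight, if_neg (by simp)]

/-- Every nonnegative multiple of the consistency value is given by nonnegative coefficients. -/
theorem exists_coef_mul_tilde (s : TreeShape) (a : ℝ) (ha : 0 ≤ a) :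
    ∃ coef : RTree, coef.shape = s ∧ coef.allNonneg ∧
      ∀ t : RTree, t.shape = s → a * t.tilde = coef.dot t := by
  obtain ⟨ss⟩ := s
  have hw := selfWeight_nonneg ss.length
  have hb : 0 ≤ a * (1 - selfWeight ss.length) :=
    mul_nonneg ha (sub_nonneg.2 (selfWeight_le_one _))
  have ih : ∀ c ∈ ss, ∃ coef : RTree, coef.shape = c ∧ coef.allNonneg ∧
      ∀ t : RTree, t.shape = c → a * (1 - selfWeight ss.length) * t.tilde = coef.dot t :=
    fun c hc => exists_coef_mul_tilde c _ hb
  have : Nonempty RTree := ⟨.node 0 []⟩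
  choose! f hshape hnonneg hdot using ih
  refine ⟨.node (a * selfWeight ss.length) (ss.map f), ?_, ?_, ?_⟩
  · rw [RTree.shape_node, List.map_map, List.map_congr_left (f := RTree.shape ∘ f) (g := id) hshape, List.map_id]
  · rw [RTree.allNonneg_node]
    exact ⟨mul_nonneg ha hw, by simpa using hnonneg⟩
  · rintro ⟨y, ds⟩ ht
    rw [RTree.shape_node, TreeShape.node.injEq] at ht
    subst ht
    have hzip : ((ds.map RTree.shape).map f).zip ds = ds.map fun d => (f d.shape, d) := by
      rw [List.map_map, List.zip_map_left, List.zip_eq_zipWith, List.zipWith_self, List.map_map]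
      rfl
    rw [RTree.dot_node, hzip, List.map_map, RTree.tilde_node, mul_add, ← mul_assoc, ← mul_assoc,
      ← List.sum_map_mul_left, List.length_map]
    congr 2
    refine List.map_congr_left fun d hd => ?_
    simpa using hdot d.shape (List.mem_map_of_mem hd) d rfl
termination_by sizeOf s
decreasing_by
  have h : sizeOf c < sizeOf ss := List.sizeOf_lt_of_mem hc
  simp_all only [TreeShape.node.sizeOf_spec]
  omega

/-- **The consistency value is a linear function of the node labels.**
For every tree shape there exists a tree of nonnegative coefficients of the same
shape such that, for every assignment of real labels to that shape, the
consistency value `f̃` equals the coefficient-weighted sum of the labels. -/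
theorem tilde_is_linear_in_labels (s : TreeShape) :
    ∃ coef : RTree, coef.shape = s ∧ coef.allNonneg ∧
      ∀ t : RTree, t.shape = s → t.tilde = coef.dot t := by
  simpa using exists_coef_mul_tilde s 1 zero_le_one
end
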